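/- Let H be a real Hilbert space, D a nonempty closed convex subset of H, T : D → D a nonexpansive mapping with F(T) ≠ ∅, and f : D → D an α-contraction with α ∈ (0,1). For each t ∈ (0,1) let x_t ∈ D be the unique solution of x = t f(x) + (1 − t) T x. Then x_t converges strongly as t → 0⁺ to a point q ∈ F(T), and this q satisfies the variational inequality ⟨q − f(q), q − p⟩ ≤ 0 for all p ∈ F(T). -/

import Mathlib

open Filter Topology
open scoped InnerProductSpace

section Helpers

variable {H : Type*} [NormedAddCommGroup H]

/-- Banach's fixed point theorem for a self-map of a complete set. -/
theorem exists_fixed_point_of_norm_sub_le {D : Set H} (hDne : D.Nonempty) (hD : IsComplete D)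
    {K : H → H} (hK : Set.MapsTo K D D) {k : ℝ} (hk0 : 0 ≤ k) (hk1 : k < 1)
    (hKk : ∀ x ∈ D, ∀ y ∈ D, ‖K x - K y‖ ≤ k * ‖x - y‖) : ∃ x ∈ D, K x = x := by
  obtain ⟨x₀, hx₀⟩ := hDne
  have hc : ContractingWith ⟨k, hk0⟩ (hK.restrict K D D) := by
    refine ⟨by exact_mod_cast hk1, LipschitzWith.of_dist_le_mul fun x y => ?_⟩
    rw [Subtype.dist_eq, Subtype.dist_eq, dist_eq_norm, dist_eq_norm]
    exact hKk x x.2 y y.2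
  obtain ⟨x, hxD, hx, -⟩ := hc.exists_fixedPoint' hD hK hx₀ (edist_ne_top _ _)
  exact ⟨x, hxD, hx⟩

/-- If `φ` is bounded above and `‖x s - x t‖ ^ 2 ≤ φ s - φ t` for `s < t` in `(0, 1)`, then
`x` has a limit at `0` from the right. -/
theorem exists_tendsto_of_norm_sub_sq_le [CompleteSpace H] {x : ℝ → H} {φ : ℝ → ℝ} {C : ℝ}
    (hC : ∀ t ∈ Set.Ioo (0 : ℝ) 1, φ t ≤ C)
    (h : ∀ s ∈ Set.Ioo (0 : ℝ) 1, ∀ t ∈ Set.Ioo (0 : ℝ) 1, s < t →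
      ‖x s - x t‖ ^ 2 ≤ φ s - φ t) :
    ∃ q, Tendsto x (𝓝[Set.Ioo (0 : ℝ) 1] 0) (𝓝 q) := by
  have hne : (𝓝[Set.Ioo (0 : ℝ) 1] 0).NeBot := left_nhdsWithin_Ioo_neBot one_pos
  apply cauchy_map_iff_exists_tendsto.1
  rw [Metric.cauchy_iff]
  refine ⟨hne.map x, fun ε hε => ?_⟩
  have hbdd : BddAbove (φ '' Set.Ioo (0 : ℝ) 1) := ⟨C, by rintro _ ⟨t, ht, rfl⟩; exact hC t ht⟩
  have hnon : (φ '' Set.Ioo (0 : ℝ) 1).Nonempty := (Set.nonempty_Ioo.2 one_pos).image φ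
  obtain ⟨_, ⟨t, ht, rfl⟩, hlt⟩ := exists_lt_of_lt_csSup hnon
    (sub_lt_self (sSup (φ '' Set.Ioo (0 : ℝ) 1)) (by positivity : 0 < (ε / 2) ^ 2))
  refine ⟨Metric.ball (x t) (ε / 2), ?_, fun y hy z hz => ?_⟩
  · rw [mem_map]
    filter_upwards [self_mem_nhdsWithin, mem_nhdsWithin_of_mem_nhds (Iio_mem_nhds ht.1)]
      with s hs hst
    have h1 := h s hs t ht hst
    have h2 := le_csSup hbdd (Set.mem_image_of_mem φ hs)
    rw [Set.mem_preimage, Metric.mem_ball, dist_eq_norm]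
    exact lt_of_pow_lt_pow_left₀ 2 (by positivity) (by linarith)
  · have := dist_triangle_right y z (x t)
    rw [Metric.mem_ball] at hy hz
    linarith

variable [InnerProductSpace ℝ H]

theorem inner_sub_map_sub_nonneg {T : H → H} {x y : H} (h : ‖T x - T y‖ ≤ ‖x - y‖) :
    0 ≤ ⟪(x - T x) - (y - T y), x - y⟫_ℝ := by
  have e : (x - T x) - (y - T y) = (x - y) - (T x - T y) := by abel
  rw [e, inner_sub_left, real_inner_self_eq_norm_sq]
  nlinarith [real_inner_le_norm (T x - T y) (x - y), norm_nonneg (x - y)]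

theorem sub_map_eq_smul_of_eq {t : ℝ} (ht : t < 1) {x v w : H}
    (h : x = t • v + (1 - t) • w) : x - w = (t / (1 - t)) • (v - x) := by
  have h1 : (1 - t) ≠ 0 := by linarith
  have e : (1 - t) • (x - w) = t • (v - x) := by
    have : t • v = x - (1 - t) • w := eq_sub_of_add_eq h.symm
    rw [smul_sub t, this]
    module
  rw [div_eq_inv_mul, mul_smul, ← e, inv_smul_smul₀ h1]

theorem inner_sub_nonneg_of_fixed {T : H → H} {t : ℝ} (ht : t ∈ Set.Ioo (0 : ℝ) 1) {x v p : H}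
    (hp : T p = p) (hTp : ‖T x - T p‖ ≤ ‖x - p‖) (h : x = t • v + (1 - t) • T x) :
    0 ≤ ⟪v - x, x - p⟫_ℝ := by
  have h1 := inner_sub_map_sub_nonneg hTp
  rw [hp, sub_self, sub_zero, sub_map_eq_smul_of_eq ht.2 h, real_inner_smul_left] at h1
  exact nonneg_of_mul_nonneg_right h1 (div_pos ht.1 (by linarith [ht.2]))

theorem norm_sub_sq_le_of_inner_nonneg {r s : ℝ} (hr : 0 < r) (hrs : r < s) {v w : H}
    (h : 0 ≤ ⟪r • v - s • w, w - v⟫_ℝ) : ‖v - w‖ ^ 2 ≤ ‖v‖ ^ 2 - ‖w‖ ^ 2 := by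
  have e := norm_sub_sq_real v w
  simp only [inner_sub_left, inner_sub_right, real_inner_smul_left, real_inner_self_eq_norm_sq,
    real_inner_comm v w] at h
  have key : (s + r) * ‖v - w‖ ^ 2 ≤ (s - r) * (‖v‖ ^ 2 - ‖w‖ ^ 2) := by
    rw [e]
    have := real_inner_comm v w
    nlinarith
  have hs : 0 < s := hr.trans hrs
  have h0 : 0 ≤ ‖v‖ ^ 2 - ‖w‖ ^ 2 :=
    nonneg_of_mul_nonneg_right ((by positivity : 0 ≤ (s + r) * ‖v - w‖ ^ 2).trans key)
      (by linarith)
  nlinarith [sq_nonneg ‖v - w‖]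

/-- Browder's theorem: the approximating path anchored at `u` converges. -/
theorem exists_tendsto_of_anchored_path [CompleteSpace H] {D : Set H} {T : H → H}
    (hTne : ∀ x ∈ D, ∀ y ∈ D, ‖T x - T y‖ ≤ ‖x - y‖) (hFne : ∃ p ∈ D, T p = p) {u : H}
    {y : ℝ → H} (hyD : ∀ t ∈ Set.Ioo (0 : ℝ) 1, y t ∈ D)
    (hy : ∀ t ∈ Set.Ioo (0 : ℝ) 1, y t = t • u + (1 - t) • T (y t)) :
    ∃ q, Tendsto y (𝓝[Set.Ioo (0 : ℝ) 1] 0) (𝓝 q) := by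
  obtain ⟨p, hpD, hp⟩ := hFne
  refine exists_tendsto_of_norm_sub_sq_le (φ := fun t => ‖u - y t‖ ^ 2) (C := ‖u - p‖ ^ 2)
    (fun t ht => ?_) (fun s hs t ht hst => ?_)
  · have h := inner_sub_nonneg_of_fixed ht hp (hTne _ (hyD t ht) _ hpD) (hy t ht)
    have e := norm_add_sq_real (u - y t) (y t - p)
    rw [sub_add_sub_cancel] at e
    nlinarith [sq_nonneg ‖y t - p‖]
  · have h := inner_sub_map_sub_nonneg (hTne _ (hyD s hs) _ (hyD t ht))
    rw [sub_map_eq_smul_of_eq hs.2 (hy s hs), sub_map_eq_smul_of_eq ht.2 (hy t ht),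
      ← sub_sub_sub_cancel_left (y t) (y s) u] at h
    have hlt : s / (1 - s) < t / (1 - t) := by
      rw [div_lt_div_iff₀ (by linarith [hs.2]) (by linarith [ht.2])]
      linarith
    have := norm_sub_sq_le_of_inner_nonneg (div_pos hs.1 (by linarith [hs.2])) hlt h
    rwa [sub_sub_sub_cancel_left, norm_sub_rev] at this

/-- Viscosity paths with nearby anchors are close. -/
theorem norm_sub_le_of_path {D : Set H} {T : H → H}
    (hTne : ∀ x ∈ D, ∀ y ∈ D, ‖T x - T y‖ ≤ ‖x - y‖) {t : ℝ} (ht : t ∈ Set.Ioo (0 : ℝ) 1)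
    {x y u v : H} (hxD : x ∈ D) (hyD : y ∈ D) (hx : x = t • u + (1 - t) • T x)
    (hy : y = t • v + (1 - t) • T y) : ‖x - y‖ ≤ ‖u - v‖ := by
  have e : x - y = t • (u - v) + (1 - t) • (T x - T y) := by
    conv_lhs => rw [hx, hy]
    module
  have h := norm_add_le (t • (u - v)) ((1 - t) • (T x - T y))
  rw [← e, norm_smul, norm_smul, Real.norm_of_nonneg ht.1.le,
    Real.norm_of_nonneg (by linarith [ht.2])] at h
  have h2 := mul_le_mul_of_nonneg_left (hTne x hxD y hyD) (by linarith [ht.2] : 0 ≤ 1 - t)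
  exact le_of_mul_le_mul_left (by linarith) ht.1

/-- For `t ∈ (0, 1)` the contraction `x ↦ t • u + (1 - t) • T x` of `D` has a fixed point. -/
theorem exists_anchored_path {D : Set H} (hDne : D.Nonempty) (hD : IsComplete D)
    (hDcv : Convex ℝ D) {T : H → H} (hTmaps : Set.MapsTo T D D)
    (hTne : ∀ x ∈ D, ∀ y ∈ D, ‖T x - T y‖ ≤ ‖x - y‖) {u : H} (hu : u ∈ D) {t : ℝ}
    (ht : t ∈ Set.Ioo (0 : ℝ) 1) : ∃ x ∈ D, x = t • u + (1 - t) • T x := by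
  have h1 : 0 ≤ 1 - t := by linarith [ht.2]
  obtain ⟨x, hxD, hx⟩ := exists_fixed_point_of_norm_sub_le (K := fun x => t • u + (1 - t) • T x)
    hDne hD (fun x hx => hDcv hu (hTmaps hx) ht.1.le h1 (by ring)) h1 (by linarith [ht.1])
    (fun x hx y hy => by
      rw [add_sub_add_left_eq_sub, ← smul_sub, norm_smul, Real.norm_of_nonneg h1]
      exact mul_le_mul_of_nonneg_left (hTne x hx y hy) h1)
  exact ⟨x, hxD, hx.symm⟩

end Helpers

/-- Lemma 1.1 of the paper (Xu's viscosity path convergence theorem),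
in the Hilbert-space setting. -/
theorem viscosity_path_converges
    {H : Type*} [NormedAddCommGroup H] [InnerProductSpace ℝ H] [CompleteSpace H]
    (D : Set H) (hDne : D.Nonempty) (hDcl : IsClosed D) (hDcv : Convex ℝ D)
    (T : H → H) (hTmaps : Set.MapsTo T D D)
    (hTne : ∀ x ∈ D, ∀ y ∈ D, ‖T x - T y‖ ≤ ‖x - y‖)
    (hFne : ∃ p ∈ D, T p = p)
    (f : H → H) (hfmaps : Set.MapsTo f D D)
    (a : ℝ) (ha : a ∈ Set.Ioo (0 : ℝ) 1)
    (hf : ∀ x ∈ D, ∀ y ∈ D, ‖f x - f y‖ ≤ a * ‖x - y‖)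
    (xt : ℝ → H)
    (hxtD : ∀ t ∈ Set.Ioo (0 : ℝ) 1, xt t ∈ D)
    (hxt : ∀ t ∈ Set.Ioo (0 : ℝ) 1, xt t = t • f (xt t) + (1 - t) • T (xt t)) :
    ∃ q ∈ D, T q = q ∧
      Tendsto xt (𝓝[Set.Ioo (0 : ℝ) 1] 0) (𝓝 q) ∧
      ∀ p ∈ D, T p = p → ⟪q - f q, q - p⟫_ℝ ≤ 0 := by
  have ht0 : Tendsto (fun t : ℝ => t) (𝓝[Set.Ioo (0 : ℝ) 1] 0) (𝓝 0) :=
    tendsto_id.mono_left nhdsWithin_le_nhds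
  have hne : (𝓝[Set.Ioo (0 : ℝ) 1] 0).NeBot := left_nhdsWithin_Ioo_neBot one_pos
  have hmem : ∀ᶠ t in 𝓝[Set.Ioo (0 : ℝ) 1] 0, t ∈ Set.Ioo (0 : ℝ) 1 := self_mem_nhdsWithin
  have hpath (u : H) (t : ℝ) :
      ∃ x, u ∈ D → t ∈ Set.Ioo (0 : ℝ) 1 → x ∈ D ∧ x = t • u + (1 - t) • T x := by
    by_cases h : u ∈ D ∧ t ∈ Set.Ioo (0 : ℝ) 1
    · obtain ⟨x, hxD, hx⟩ :=
        exists_anchored_path hDne hDcl.isComplete hDcv hTmaps hTne h.1 h.2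
      exact ⟨x, fun _ _ => ⟨hxD, hx⟩⟩
    · exact ⟨0, fun h1 h2 => absurd ⟨h1, h2⟩ h⟩
  choose y hy using hpath
  have hlim (u : H) : ∃ q, u ∈ D → Tendsto (y u) (𝓝[Set.Ioo (0 : ℝ) 1] 0) (𝓝 q) := by
    by_cases hu : u ∈ D
    · obtain ⟨q, hq⟩ := exists_tendsto_of_anchored_path hTne hFne
        (fun t ht => (hy u t hu ht).1) (fun t ht => (hy u t hu ht).2)
      exact ⟨q, fun _ => hq⟩
    · exact ⟨0, fun h => absurd h hu⟩
  choose Q hQ using hlim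
  have hQmaps : Set.MapsTo Q D D := fun u hu =>
    hDcl.mem_of_tendsto (hQ u hu) (hmem.mono fun t ht => (hy u t hu ht).1)
  have hQne : ∀ u ∈ D, ∀ v ∈ D, ‖Q u - Q v‖ ≤ ‖u - v‖ := fun u hu v hv =>
    le_of_tendsto ((hQ u hu).sub (hQ v hv)).norm (hmem.mono fun t ht =>
      norm_sub_le_of_path hTne ht (hy u t hu ht).1 (hy v t hv ht).1
        (hy u t hu ht).2 (hy v t hv ht).2)
  obtain ⟨q, hqD, hq⟩ := exists_fixed_point_of_norm_sub_le (K := fun x => Q (f x)) hDne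
    hDcl.isComplete (fun x hx => hQmaps (hfmaps hx)) ha.1.le ha.2 (fun x hx z hz =>
      (hQne _ (hfmaps hx) _ (hfmaps hz)).trans (hf x hx z hz))
  have hyq : Tendsto (y (f q)) (𝓝[Set.Ioo (0 : ℝ) 1] 0) (𝓝 q) := by
    simpa only [hq] using hQ (f q) (hfmaps hqD)
  have hx : Tendsto xt (𝓝[Set.Ioo (0 : ℝ) 1] 0) (𝓝 q) := by
    rw [tendsto_iff_norm_sub_tendsto_zero] at hyq ⊢
    have hb : Tendsto (fun t => (1 - a)⁻¹ * ‖y (f q) t - q‖) (𝓝[Set.Ioo (0 : ℝ) 1] 0) (𝓝 0) := by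
      simpa using hyq.const_mul (1 - a)⁻¹
    refine squeeze_zero' (Eventually.of_forall fun _ => norm_nonneg _) (hmem.mono fun t ht => ?_) hb
    have hyt := hy (f q) t (hfmaps hqD) ht
    have h1 := norm_sub_le_of_path hTne ht (hxtD t ht) hyt.1 (hxt t ht) hyt.2
    have h2 := hf _ (hxtD t ht) _ hqD
    have h3 := norm_sub_le_norm_sub_add_norm_sub (xt t) (y (f q) t) q
    rw [le_inv_mul_iff₀ (by linarith [ha.2])]
    linarith
  have hcont {g : H → H} {c : ℝ} (hg : ∀ x ∈ D, ∀ z ∈ D, ‖g x - g z‖ ≤ c * ‖x - z‖) :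
      Tendsto (fun t => g (xt t)) (𝓝[Set.Ioo (0 : ℝ) 1] 0) (𝓝 (g q)) := by
    rw [tendsto_iff_norm_sub_tendsto_zero] at hx ⊢
    refine squeeze_zero' (Eventually.of_forall fun _ => norm_nonneg _)
      (hmem.mono fun t ht => hg _ (hxtD t ht) _ hqD) (by simpa using hx.const_mul c)
  have hfx := hcont hf
  have hTx := hcont (g := T) (c := 1) (by simpa using hTne)
  refine ⟨q, hqD, ?_, hx, fun p hpD hp => ?_⟩
  · have h := (ht0.smul hfx).add ((ht0.const_sub 1).smul hTx)
    simp only [zero_smul, sub_zero, one_smul, zero_add] at h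
    exact tendsto_nhds_unique h (hx.congr' (hmem.mono fun t ht => hxt t ht))
  · have h : 0 ≤ ⟪f q - q, q - p⟫_ℝ :=
      ge_of_tendsto ((hfx.sub hx).inner (hx.sub_const p)) (hmem.mono fun t ht =>
        inner_sub_nonneg_of_fixed ht hp (hTne _ (hxtD t ht) _ hpD) (hxt t ht))
    rw [← neg_sub, inner_neg_left]
    linarith
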